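/- Claim (claim-incr, entropy growth along a random binary input): Let 1/2 < p ≤ 1, let U₀ and U₁ be unitary d×d complex matrices, and let P be a d×d orthogonal projection (Hermitian with P² = P). Let ρ₀ = |ψ⟩⟨ψ| for some unit vector ψ ∈ ℂ^d (a pure state), and define recursively ρ_k = ½(U₀ ρ_{k−1} U₀† + U₁ ρ_{k−1} U₁†) for k ≥ 1. Suppose that for every k with 0 ≤ k < n the measurement distinguishes the last symbol with probability at least p: Tr((I − P) U₀ ρ_k U₀†) ≥ p and Tr(P U₁ ρ_k U₁†) ≥ p. Then for every k with 0 ≤ k ≤ n, S(ρ_k) ≥ (1 − H(p))·k. -/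

import Mathlib

open Matrix
open scoped ComplexOrder

/-- The von Neumann entropy (in bits) of a matrix: `S(ρ) = −Σᵢ λᵢ log₂ λᵢ` where
the `λᵢ` are the eigenvalues of `ρ` (defined to be `0` on non-Hermitian matrices). -/
noncomputable def vnEntropy {d : ℕ} (ρ : Matrix (Fin d) (Fin d) ℂ) : ℝ :=
  if h : ρ.IsHermitian then -∑ i, h.eigenvalues i * Real.logb 2 (h.eigenvalues i) else 0

/-- The binary entropy function `H(p) = −p log₂ p − (1−p) log₂ (1−p)`. -/
noncomputable def binH (p : ℝ) : ℝ :=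
  -(p * Real.logb 2 p) - (1 - p) * Real.logb 2 (1 - p)

/-- If the weights `c` sum to zero and `∑ c j / (r j + t) ≥ 0` for all `t > 0`, then
`∑ c j * log (r j) ≤ 0`. -/
lemma sum_mul_log_nonpos {J : Type*} [Fintype J] (c r : J → ℝ)
    (hr : ∀ j, c j ≠ 0 → 0 < r j) (hc : ∑ j, c j = 0)
    (h : ∀ t : ℝ, 0 < t → 0 ≤ ∑ j, c j / (r j + t)) :
    ∑ j, c j * Real.log (r j) ≤ 0 := by
  have hder : ∀ t : ℝ, 0 ≤ t →
      HasDerivAt (fun t => ∑ j, c j * Real.log (r j + t)) (∑ j, c j / (r j + t)) t := by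
    intro t ht
    refine HasDerivAt.fun_sum fun j _ => ?_
    by_cases hj : c j = 0
    · simpa [hj] using hasDerivAt_const t (0 : ℝ)
    · have hpos : r j + t ≠ 0 := by have := hr j hj; positivity
      simpa [div_eq_mul_inv] using
        (((hasDerivAt_id t).const_add (r j)).log hpos).const_mul (c j)
  have hmono : MonotoneOn (fun t => ∑ j, c j * Real.log (r j + t)) (Set.Ici 0) := by
    refine monotoneOn_of_deriv_nonneg (convex_Ici 0)
      (fun t ht => (hder t ht).continuousAt.continuousWithinAt) ?_ ?_
    · intro t ht
      rw [interior_Ici] at ht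
      exact (hder t (le_of_lt ht)).differentiableAt.differentiableWithinAt
    · intro t ht
      rw [interior_Ici] at ht
      rw [(hder t (le_of_lt ht)).deriv]
      exact h t ht
  have hlim : Filter.Tendsto (fun t => ∑ j, c j * Real.log (r j + t)) Filter.atTop (nhds 0) := by
    have h1 : Filter.Tendsto (fun t => ∑ j, c j * (Real.log (t + r j) - Real.log t))
        Filter.atTop (nhds (∑ j, c j * 0)) :=
      tendsto_finsetSum _ fun j _ => (Real.tendsto_log_comp_add_sub_log (r j)).const_mul (c j)
    simp only [mul_zero, Finset.sum_const_zero] at h1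
    refine h1.congr fun t => ?_
    simp only [mul_sub, Finset.sum_sub_distrib, ← Finset.sum_mul, hc, zero_mul, sub_zero, add_comm]
  have := ge_of_tendsto hlim (b := ∑ j, c j * Real.log (r j))
    (Filter.eventually_atTop.2 ⟨0, fun t ht => by
      simpa using hmono (Set.mem_Ici.2 le_rfl) (Set.mem_Ici.2 ht) ht⟩)
  exact this

lemma sum_mul_log_le_sum_mul_log {J K : Type*} [Fintype J] [Fintype K] (c r : J → ℝ) (c' r' : K → ℝ)
    (hr : ∀ j, c j ≠ 0 → 0 < r j) (hr' : ∀ k, c' k ≠ 0 → 0 < r' k)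
    (hc : ∑ j, c j = ∑ k, c' k)
    (h : ∀ t : ℝ, 0 < t → ∑ k, c' k / (r' k + t) ≤ ∑ j, c j / (r j + t)) :
    ∑ j, c j * Real.log (r j) ≤ ∑ k, c' k * Real.log (r' k) := by
  have := sum_mul_log_nonpos (Sum.elim c (fun k => -c' k)) (Sum.elim r r')
    (by rintro (j | k) hj
        · exact hr j hj
        · exact hr' k (by simpa using hj))
    (by simp [hc])
    (fun t ht => by simpa [neg_div] using h t ht)
  simpa using this

section Trace

variable {ι : Type*} [Fintype ι]

lemma trace_mul_re_nonneg_of_proj {P σ : Matrix ι ι ℂ} (hPh : P.IsHermitian) (hP2 : P * P = P)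
    (hσ : σ.PosSemidef) : 0 ≤ (P * σ).trace.re := by
  have h := (hσ.mul_mul_conjTranspose_same P).trace_nonneg
  rw [hPh.eq, trace_mul_comm, ← Matrix.mul_assoc, hP2] at h
  exact (Complex.le_def.1 h).1

variable [DecidableEq ι]

lemma re_trace_mul_diagonal_mul_conjTranspose (M N : Matrix ι ι ℂ) (l : ι → ℝ) :
    ((N * diagonal (fun a => (l a : ℂ)) * Mᴴ).trace).re =
      ∑ b, ∑ a, l a * (star (M b a) * N b a).re := by
  simp only [trace, diag_apply, mul_apply (M := N * _), mul_diagonal, Complex.re_sum,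
    conjTranspose_apply]
  refine Finset.sum_congr rfl fun b _ => Finset.sum_congr rfl fun a _ => ?_
  simp
  ring

lemma re_trace_mul_diagonal_mul_conjTranspose_self (N : Matrix ι ι ℂ) (l : ι → ℝ) :
    ((N * diagonal (fun a => (l a : ℂ)) * Nᴴ).trace).re =
      ∑ b, ∑ a, l a * Complex.normSq (N b a) := by
  rw [re_trace_mul_diagonal_mul_conjTranspose]
  refine Finset.sum_congr rfl fun b _ => Finset.sum_congr rfl fun a _ => ?_
  simp [Complex.normSq_apply]

lemma two_mul_re_sub_le_normSq_mul_div (z y : ℂ) {l k : ℝ} (hk : 0 ≤ k) (h : k = 0 → l = 0) :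
    2 * (l * (star z * y).re) - k * Complex.normSq y ≤ Complex.normSq z * l ^ 2 / k := by
  rcases hk.eq_or_lt with hk | hk
  · simp [← hk, h hk.symm]
  · rw [le_div_iff₀ hk]
    simp only [Complex.normSq_apply, Complex.mul_re, Complex.star_def, Complex.conj_re,
      Complex.conj_im]
    nlinarith [sq_nonneg (l * z.re - k * y.re), sq_nonneg (l * z.im - k * y.im)]

/-- The variational lower bound on the quadratic form of `(L_τ + t R_σ)⁻¹`, for
`σ = A diag(l) Aᴴ` and `τ = B diag(m) Bᴴ`. -/
lemma two_mul_re_trace_sub_le {A B X : Matrix ι ι ℂ} (hA : A * Aᴴ = 1) (hB : B * Bᴴ = 1)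
    (hX : X.IsHermitian) {l m : ι → ℝ} (hl : ∀ a, 0 ≤ l a) (hm : ∀ b, 0 ≤ m b)
    {t : ℝ} (ht : 0 < t) :
    2 * (X * (A * diagonal (fun a => (l a : ℂ)) * Aᴴ)).trace.re
      - (X * X * (B * diagonal (fun b => (m b : ℂ)) * Bᴴ)).trace.re
      - t * (X * X * (A * diagonal (fun a => (l a : ℂ)) * Aᴴ)).trace.re
    ≤ ∑ b, ∑ a, Complex.normSq ((Bᴴ * A) b a) * l a ^ 2 / (m b + t * l a) := by
  have e1 : (X * (A * diagonal (fun a => (l a : ℂ)) * Aᴴ)).trace.re =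
      ∑ b, ∑ a, l a * (star ((Bᴴ * A) b a) * (Bᴴ * X * A) b a).re := by
    rw [← re_trace_mul_diagonal_mul_conjTranspose, conjTranspose_mul, conjTranspose_conjTranspose,
      ← Matrix.mul_assoc _ Aᴴ B, trace_mul_comm _ B]
    simp only [← Matrix.mul_assoc, hB, Matrix.one_mul]
  have e2 : (X * X * (A * diagonal (fun a => (l a : ℂ)) * Aᴴ)).trace.re =
      ∑ b, ∑ a, l a * Complex.normSq ((Bᴴ * X * A) b a) := by
    rw [← re_trace_mul_diagonal_mul_conjTranspose_self, conjTranspose_mul, conjTranspose_mul,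
      conjTranspose_conjTranspose, hX.eq, ← Matrix.mul_assoc _ Aᴴ (X * B), ← Matrix.mul_assoc _ X B,
      trace_mul_comm _ B, Matrix.mul_assoc X X, trace_mul_comm X]
    simp only [← Matrix.mul_assoc, hB, Matrix.one_mul]
  have e3 : (X * X * (B * diagonal (fun b => (m b : ℂ)) * Bᴴ)).trace.re =
      ∑ b, ∑ a, m b * Complex.normSq ((Bᴴ * X * A) b a) := by
    have e : ∑ b, ∑ a, m b * Complex.normSq ((Bᴴ * X * A) b a) =
        ∑ a, ∑ b, m b * Complex.normSq ((Bᴴ * X * A)ᴴ a b) := by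
      rw [Finset.sum_comm]
      simp [conjTranspose_apply, Complex.normSq_conj]
    rw [e, ← re_trace_mul_diagonal_mul_conjTranspose_self, conjTranspose_conjTranspose,
      conjTranspose_mul, conjTranspose_mul, conjTranspose_conjTranspose, hX.eq,
      ← Matrix.mul_assoc _ (Bᴴ * X) A, trace_mul_comm _ A, Matrix.mul_assoc X X, trace_mul_comm X]
    simp only [← Matrix.mul_assoc, hA, Matrix.one_mul]
  rw [e1, e2, e3]
  simp only [Finset.mul_sum, ← Finset.sum_sub_distrib]
  refine Finset.sum_le_sum fun b _ => Finset.sum_le_sum fun a _ => ?_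
  have hpos : 0 ≤ t * l a := mul_nonneg ht.le (hl a)
  refine le_trans (le_of_eq ?_) (two_mul_re_sub_le_normSq_mul_div ((Bᴴ * A) b a)
    ((Bᴴ * X * A) b a) (add_nonneg (hm b) hpos) fun h => ?_)
  · ring
  · have := hm b
    have h0 : t * l a = 0 := by linarith
    exact (mul_eq_zero.1 h0).resolve_left ht.ne'

end Trace

section Gain

variable {ι : Type*} [Fintype ι]

/-- The entropy gain `S(τ) - S(ρ) ≥ log 2 - h(m)` in natural units, for spectra `l` of `ρ` and
`μ` of `τ`, where the transition weights `w` come from two unitaries. -/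
lemma spectral_entropy_gain (w : Bool → ι → ι → ℝ) (hw : ∀ i b a, 0 ≤ w i b a)
    (hcol : ∀ i a, ∑ b, w i b a = 1) {l μ : ι → ℝ} (hl : ∀ a, 0 ≤ l a) (hl1 : ∑ a, l a = 1)
    (hrow : ∀ b, 1 / 2 * ∑ i, ∑ a, w i b a * l a = μ b)
    {m : ℝ} (hm0 : 0 ≤ m) (hm1 : m ≤ 1)
    (h : ∀ t : ℝ, 0 < t → m ^ 2 / (1 / 2 + t * m) + (1 - m) ^ 2 / (1 / 2 + t * (1 - m)) ≤
      1 / 2 * ∑ i, ∑ b, ∑ a, w i b a * l a ^ 2 / (μ b + t * l a)) :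
    Real.log 2 - Real.binEntropy m ≤ ∑ a, l a * Real.log (l a) - ∑ b, μ b * Real.log (μ b) := by
  have hμ : ∀ b, 0 ≤ μ b := fun b => by
    rw [← hrow]
    exact mul_nonneg (by norm_num) (Finset.sum_nonneg fun i _ => Finset.sum_nonneg fun a _ =>
      mul_nonneg (hw i b a) (hl a))
  have hsupp : ∀ i b a, w i b a * l a ≠ 0 → 0 < l a ∧ 0 < μ b := by
    intro i b a hne
    have h1 : 0 < l a := lt_of_le_of_ne (hl a) (by rintro h; simp [← h] at hne)
    have h2 : 0 < w i b a * l a := lt_of_le_of_ne (mul_nonneg (hw i b a) (hl a)) (Ne.symm hne)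
    refine ⟨h1, ?_⟩
    rw [← hrow]
    refine mul_pos (by norm_num) (lt_of_lt_of_le h2 ?_)
    refine le_trans ?_ (Finset.single_le_sum (f := fun i => ∑ a, w i b a * l a)
      (fun i _ => Finset.sum_nonneg fun a _ => mul_nonneg (hw i b a) (hl a)) (Finset.mem_univ i))
    exact Finset.single_le_sum (f := fun a => w i b a * l a)
      (fun a _ => mul_nonneg (hw i b a) (hl a)) (Finset.mem_univ a)
  have hswap : ∀ f : ι → ℝ, ∑ i, ∑ b, ∑ a, 1 / 2 * (w i b a * l a) * f a = ∑ a, l a * f a := by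
    intro f
    have : ∀ i : Bool, ∑ b, ∑ a, 1 / 2 * (w i b a * l a) * f a = 1 / 2 * ∑ a, l a * f a := by
      intro i
      rw [Finset.sum_comm, Finset.mul_sum]
      refine Finset.sum_congr rfl fun a _ => ?_
      calc _ = (∑ b, w i b a) * (1 / 2 * (l a * f a)) := by
            rw [Finset.sum_mul]; exact Finset.sum_congr rfl fun b _ => by ring
        _ = _ := by rw [hcol, one_mul]
    rw [Fintype.sum_bool, this, this]
    ring
  have hswap' : ∀ f : ι → ℝ, ∑ i, ∑ b, ∑ a, 1 / 2 * (w i b a * l a) * f b = ∑ b, μ b * f b := by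
    intro f
    rw [Finset.sum_comm]
    refine Finset.sum_congr rfl fun b _ => ?_
    rw [← hrow, Finset.mul_sum, Finset.sum_mul]
    refine Finset.sum_congr rfl fun i _ => ?_
    rw [Finset.mul_sum, Finset.sum_mul]
  have key := sum_mul_log_le_sum_mul_log
    (J := Bool × ι × ι) (K := Bool)
    (fun j => 1 / 2 * (w j.1 j.2.1 j.2.2 * l j.2.2)) (fun j => μ j.2.1 / l j.2.2)
    (fun k => cond k m (1 - m)) (fun k => 1 / (2 * cond k m (1 - m)))
    (fun j hj => by
      obtain ⟨h1, h2⟩ := hsupp j.1 j.2.1 j.2.2 (right_ne_zero_of_mul hj)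
      exact div_pos h2 h1)
    (fun k hk => by
      have : 0 ≤ cond k m (1 - m) := by cases k <;> simp <;> linarith
      have : 0 < cond k m (1 - m) := lt_of_le_of_ne this (Ne.symm hk)
      positivity)
    (by
      have := hswap (fun _ => 1)
      simp only [mul_one, hl1] at this
      simp only [Fintype.sum_prod_type]
      rw [this]
      simp)
    (fun t ht => by
      have e : ∀ q : ℝ, 0 ≤ q → q / (1 / (2 * q) + t) = q ^ 2 / (1 / 2 + t * q) := by
        intro q hq
        rcases hq.eq_or_lt with rfl | hq
        · simp
        · field_simp
      have h1 := h t ht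
      simp only [Fintype.sum_bool, cond_true, cond_false]
      rw [e m hm0, e (1 - m) (by linarith)]
      refine h1.trans (le_of_eq ?_)
      simp only [Fintype.sum_prod_type, Finset.mul_sum]
      refine Finset.sum_congr rfl fun i _ => Finset.sum_congr rfl fun b _ =>
        Finset.sum_congr rfl fun a _ => ?_
      rcases (hl a).eq_or_lt with h0 | h0
      · simp [← h0]
      · have := hμ b
        have h3 : 0 < μ b + t * l a := by positivity
        have h4 : 0 < μ b / l a + t := by positivity
        field_simp)
  have eL : ∑ j : Bool × ι × ι, 1 / 2 * (w j.1 j.2.1 j.2.2 * l j.2.2) *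
      Real.log (μ j.2.1 / l j.2.2) = ∑ b, μ b * Real.log (μ b) - ∑ a, l a * Real.log (l a) := by
    rw [← hswap fun a => Real.log (l a), ← hswap' fun b => Real.log (μ b)]
    simp only [Fintype.sum_prod_type, ← Finset.sum_sub_distrib]
    refine Finset.sum_congr rfl fun i _ => Finset.sum_congr rfl fun b _ =>
        Finset.sum_congr rfl fun a _ => ?_
    by_cases h0 : w i b a * l a = 0
    · simp [h0]
    · obtain ⟨h1, h2⟩ := hsupp i b a h0
      rw [Real.log_div h2.ne' h1.ne']
      ring
  rw [eL] at key
  have eR : ∀ q : ℝ, q * Real.log (1 / (2 * q)) = q * Real.log q⁻¹ - q * Real.log 2 := by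
    intro q
    by_cases hq : q = 0
    · simp [hq]
    · rw [one_div, Real.log_inv, Real.log_inv, Real.log_mul two_ne_zero hq]
      ring
  simp only [Fintype.sum_bool, cond_true, cond_false, eR] at key
  rw [Real.binEntropy]
  linarith

variable [DecidableEq ι]

/-- The two-outcome tester `x (1 - P) + y P`. -/
lemma proj_combination {P : Matrix ι ι ℂ} (hPh : P.IsHermitian) (hP2 : P * P = P) (x y : ℝ) :
    ((x : ℂ) • (1 - P) + (y : ℂ) • P).IsHermitian ∧
    (∀ σ : Matrix ι ι ℂ, σ.trace = 1 → (((x : ℂ) • (1 - P) + (y : ℂ) • P) * σ).trace.re =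
      x * (1 - (P * σ).trace.re) + y * (P * σ).trace.re) ∧
    (((x : ℂ) • (1 - P) + (y : ℂ) • P) * ((x : ℂ) • (1 - P) + (y : ℂ) • P)) =
      (((x ^ 2 : ℝ) : ℂ) • (1 - P) + ((y ^ 2 : ℝ) : ℂ) • P) := by
  refine ⟨?_, ?_, ?_⟩
  · simp [Matrix.IsHermitian, hPh.eq]
  · intro σ hσ
    simp [Matrix.add_mul, Matrix.sub_mul, hσ]
  · have h1 : (1 - P) * (1 - P) = 1 - P := by
      simp [Matrix.sub_mul, Matrix.mul_sub, hP2]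
    have h2 : (1 - P) * P = 0 := by simp [Matrix.sub_mul, hP2]
    have h3 : P * (1 - P) = 0 := by simp [Matrix.mul_sub, hP2]
    simp only [Matrix.add_mul, Matrix.mul_add, Matrix.smul_mul, Matrix.mul_smul, h1, h2, h3, hP2,
      smul_smul, smul_zero, add_zero, zero_add, pow_two, Complex.ofReal_mul]

lemma resolvent_sum_ge {A₀ A₁ B P : Matrix ι ι ℂ} (hA₀ : A₀ * A₀ᴴ = 1) (hA₁ : A₁ * A₁ᴴ = 1)
    (hB : B * Bᴴ = 1) (hPh : P.IsHermitian) (hP2 : P * P = P) {l μ : ι → ℝ}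
    (hl : ∀ a, 0 ≤ l a) (hμ : ∀ b, 0 ≤ μ b)
    {σ₀ σ₁ τ : Matrix ι ι ℂ}
    (hσ₀ : σ₀ = A₀ * diagonal (fun a => (l a : ℂ)) * A₀ᴴ)
    (hσ₁ : σ₁ = A₁ * diagonal (fun a => (l a : ℂ)) * A₁ᴴ)
    (hτ : τ = B * diagonal (fun b => (μ b : ℂ)) * Bᴴ)
    (ht₀ : σ₀.trace = 1) (ht₁ : σ₁.trace = 1) (htτ : τ.trace = 1)
    {m : ℝ} (hm : m = ((1 - (P * σ₀).trace.re) + (P * σ₁).trace.re) / 2)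
    (hm0 : 0 ≤ m) (hm1 : m ≤ 1) {t : ℝ} (ht : 0 < t) :
    m ^ 2 / (1 / 2 + t * m) + (1 - m) ^ 2 / (1 / 2 + t * (1 - m)) ≤
      1 / 2 * ∑ b, ∑ a, Complex.normSq ((Bᴴ * A₀) b a) * l a ^ 2 / (μ b + t * l a) +
      1 / 2 * ∑ b, ∑ a, Complex.normSq ((Bᴴ * A₁) b a) * l a ^ 2 / (μ b + t * l a) := by
  have hd0 : 0 < 1 / 2 + t * m := by positivity
  have hd1 : 0 < 1 / 2 + t * (1 - m) := by
    have : 0 ≤ 1 - m := by linarith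
    positivity
  obtain ⟨x, hx⟩ : ∃ x, x = m / (1 / 2 + t * m) := ⟨_, rfl⟩
  obtain ⟨y, hy⟩ : ∃ y, y = (1 - m) / (1 / 2 + t * (1 - m)) := ⟨_, rfl⟩
  have hx' : x * (1 / 2 + t * m) = m := by rw [hx, div_mul_cancel₀ _ hd0.ne']
  have hy' : y * (1 / 2 + t * (1 - m)) = 1 - m := by rw [hy, div_mul_cancel₀ _ hd1.ne']
  have e0 : m ^ 2 / (1 / 2 + t * m) = m * x := by rw [hx]; ring
  have e1 : (1 - m) ^ 2 / (1 / 2 + t * (1 - m)) = (1 - m) * y := by rw [hy]; ring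
  obtain ⟨hX, hXt, hXX⟩ := proj_combination hPh hP2 x y
  obtain ⟨hY, hYt, hYY⟩ := proj_combination hPh hP2 y x
  have k0 := two_mul_re_trace_sub_le hA₀ hB hX hl hμ ht
  have k1 := two_mul_re_trace_sub_le hA₁ hB hY hl hμ ht
  rw [← hσ₀, ← hτ, hXX, hXt _ ht₀, (proj_combination hPh hP2 (x ^ 2) (y ^ 2)).2.1 _ ht₀,
    (proj_combination hPh hP2 (x ^ 2) (y ^ 2)).2.1 _ htτ] at k0
  rw [← hσ₁, ← hτ, hYY, hYt _ ht₁, (proj_combination hPh hP2 (y ^ 2) (x ^ 2)).2.1 _ ht₁,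
    (proj_combination hPh hP2 (y ^ 2) (x ^ 2)).2.1 _ htτ] at k1
  rw [e0, e1]
  generalize (P * σ₀).trace.re = α at *
  generalize (P * σ₁).trace.re = β at *
  generalize (P * τ).trace.re = s at *
  have e2 : x * (x * (1 / 2 + t * m)) = x * m := by rw [hx']
  have e3 : y * (y * (1 / 2 + t * (1 - m))) = y * (1 - m) := by rw [hy']
  subst hm
  linarith

lemma sum_normSq_col {M : Matrix ι ι ℂ} (hM : Mᴴ * M = 1) (a : ι) :
    ∑ b, Complex.normSq (M b a) = 1 := by
  have h := congrArg Complex.re (congrFun (congrFun hM a) a)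
  simpa [mul_apply, Complex.normSq_apply] using h

lemma diag_conj_re (M : Matrix ι ι ℂ) (l : ι → ℝ) (b : ι) :
    ((M * diagonal (fun a => (l a : ℂ)) * Mᴴ) b b).re = ∑ a, Complex.normSq (M b a) * l a := by
  simp only [mul_apply (M := M * _), mul_diagonal, Complex.re_sum, conjTranspose_apply]
  refine Finset.sum_congr rfl fun a _ => ?_
  simp [Complex.normSq_apply]
  ring

end Gain

lemma spectral_mul {d : ℕ} {ρ : Matrix (Fin d) (Fin d) ℂ} (h : ρ.IsHermitian) :
    ρ = (h.eigenvectorUnitary : Matrix (Fin d) (Fin d) ℂ) *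
      diagonal (fun a => (h.eigenvalues a : ℂ)) *
      (h.eigenvectorUnitary : Matrix (Fin d) (Fin d) ℂ)ᴴ := by
  conv_lhs => rw [h.spectral_theorem, Unitary.conjStarAlgAut_apply]
  rfl

lemma vnEntropy_mul_log_two {d : ℕ} {ρ : Matrix (Fin d) (Fin d) ℂ} (h : ρ.IsHermitian) :
    vnEntropy ρ * Real.log 2 = -∑ i, h.eigenvalues i * Real.log (h.eigenvalues i) := by
  have : Real.log 2 ≠ 0 := (Real.log_pos one_lt_two).ne'
  rw [vnEntropy, dif_pos h, neg_mul, Finset.sum_mul]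
  congr 1
  refine Finset.sum_congr rfl fun i _ => ?_
  rw [Real.logb]
  field_simp

lemma binH_mul_log_two (p : ℝ) : binH p * Real.log 2 = Real.binEntropy p := by
  have : Real.log 2 ≠ 0 := (Real.log_pos one_lt_two).ne'
  rw [binH, Real.binEntropy, Real.logb, Real.logb, Real.log_inv, Real.log_inv]
  field_simp
  ring

lemma sum_eigenvalues_eq_one {d : ℕ} {ρ : Matrix (Fin d) (Fin d) ℂ} (h : ρ.IsHermitian)
    (htr : ρ.trace = 1) : ∑ i, h.eigenvalues i = 1 := by
  have := h.trace_eq_sum_eigenvalues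
  rw [htr] at this
  apply Complex.ofReal_injective
  simpa using this.symm

lemma vnEntropy_nonneg {d : ℕ} {ρ : Matrix (Fin d) (Fin d) ℂ} (h : ρ.PosSemidef)
    (htr : ρ.trace = 1) : 0 ≤ vnEntropy ρ := by
  rw [vnEntropy, dif_pos h.isHermitian, ← Finset.sum_neg_distrib]
  refine Finset.sum_nonneg fun i _ => ?_
  have h0 := h.eigenvalues_nonneg
  have h1 : h.isHermitian.eigenvalues i ≤ 1 :=
    (Finset.single_le_sum (fun j _ => h0 j) (Finset.mem_univ i)).trans_eq
      (sum_eigenvalues_eq_one h.isHermitian htr)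
  exact neg_nonneg.2 (mul_nonpos_of_nonneg_of_nonpos (h0 i)
    (Real.logb_nonpos one_lt_two (h0 i) h1))

lemma trace_unitary_conj {d : ℕ} {U : Matrix (Fin d) (Fin d) ℂ}
    (hU : U ∈ Matrix.unitaryGroup (Fin d) ℂ) (ρ : Matrix (Fin d) (Fin d) ℂ) :
    (U * ρ * Uᴴ).trace = ρ.trace := by
  have : Uᴴ * U = 1 := mem_unitaryGroup_iff'.1 hU
  rw [trace_mul_comm, ← Matrix.mul_assoc, this, Matrix.one_mul]

/-- One step of the evolution increases the entropy by at least `1 - H(p)`. -/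
lemma vnEntropy_add_le {d : ℕ} {p : ℝ} (hp : 1 / 2 < p)
    {U₀ U₁ P ρ τ : Matrix (Fin d) (Fin d) ℂ}
    (hU₀ : U₀ ∈ Matrix.unitaryGroup (Fin d) ℂ) (hU₁ : U₁ ∈ Matrix.unitaryGroup (Fin d) ℂ)
    (hPh : P.IsHermitian) (hP2 : P * P = P) (hρ : ρ.PosSemidef) (hρ1 : ρ.trace = 1)
    (hτ : τ.PosSemidef) (hτ1 : τ.trace = 1)
    (hτρ : τ = (1 / 2 : ℂ) • (U₀ * ρ * U₀ᴴ + U₁ * ρ * U₁ᴴ))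
    (h₀ : p ≤ (((1 - P) * (U₀ * ρ * U₀ᴴ)).trace).re)
    (h₁ : p ≤ ((P * (U₁ * ρ * U₁ᴴ)).trace).re) :
    vnEntropy ρ + (1 - binH p) ≤ vnEntropy τ := by
  have hσ₀1 := (trace_unitary_conj hU₀ ρ).trans hρ1
  have hσ₁1 := (trace_unitary_conj hU₁ ρ).trans hρ1
  have hQh : (1 - P).IsHermitian := isHermitian_one.sub hPh
  have hQ2 : (1 - P) * (1 - P) = 1 - P := by simp [Matrix.sub_mul, Matrix.mul_sub, hP2]
  have hcompl : ∀ σ : Matrix (Fin d) (Fin d) ℂ, σ.trace = 1 →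
      ((1 - P) * σ).trace.re = 1 - (P * σ).trace.re := by
    intro σ hσ
    simp [Matrix.sub_mul, hσ]
  have b0 := trace_mul_re_nonneg_of_proj hPh hP2 (hρ.mul_mul_conjTranspose_same U₀)
  have b1 := trace_mul_re_nonneg_of_proj hQh hQ2 (hρ.mul_mul_conjTranspose_same U₁)
  rw [hcompl _ hσ₁1] at b1
  rw [hcompl _ hσ₀1] at h₀
  obtain ⟨m, hm⟩ : ∃ m, m = ((1 - (P * (U₀ * ρ * U₀ᴴ)).trace.re) +
    (P * (U₁ * ρ * U₁ᴴ)).trace.re) / 2 := ⟨_, rfl⟩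
  have hpm : p ≤ m := by linarith
  have hm1 : m ≤ 1 := by linarith
  have hent : Real.binEntropy m ≤ Real.binEntropy p :=
    Real.binEntropy_strictAntiOn.antitoneOn ⟨by norm_num at hp ⊢; linarith, hpm.trans hm1⟩
      ⟨by norm_num at hp ⊢; linarith, hm1⟩ hpm
  obtain ⟨V, hV⟩ : ∃ V : Matrix (Fin d) (Fin d) ℂ, V = hρ.isHermitian.eigenvectorUnitary :=
    ⟨_, rfl⟩
  obtain ⟨W, hW⟩ : ∃ W : Matrix (Fin d) (Fin d) ℂ, W = hτ.isHermitian.eigenvectorUnitary :=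
    ⟨_, rfl⟩
  have hVm : V ∈ Matrix.unitaryGroup (Fin d) ℂ := hV ▸ SetLike.coe_mem _
  have hWm : W ∈ Matrix.unitaryGroup (Fin d) ℂ := hW ▸ SetLike.coe_mem _
  have hWsm : Wᴴ ∈ Matrix.unitaryGroup (Fin d) ℂ := Unitary.star_mem hWm
  have hρs := spectral_mul hρ.isHermitian
  have hτs := spectral_mul hτ.isHermitian
  rw [← hV] at hρs
  rw [← hW] at hτs
  set l := hρ.isHermitian.eigenvalues with hl
  set μ := hτ.isHermitian.eigenvalues with hμ
  have hσs : ∀ U : Matrix (Fin d) (Fin d) ℂ, U * ρ * Uᴴ =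
      (U * V) * diagonal (fun a => (l a : ℂ)) * (U * V)ᴴ := by
    intro U
    conv_lhs => rw [hρs]
    simp only [conjTranspose_mul, Matrix.mul_assoc]
  obtain ⟨U, hU⟩ : ∃ U : Bool → Matrix (Fin d) (Fin d) ℂ, U = fun i => cond i U₀ U₁ := ⟨_, rfl⟩
  have hUm : ∀ i, U i ∈ Matrix.unitaryGroup (Fin d) ℂ := by
    intro i
    cases i <;> simp [hU, hU₀, hU₁]
  have gain := spectral_entropy_gain
    (fun i b a => Complex.normSq ((Wᴴ * (U i * V)) b a)) (fun _ _ _ => Complex.normSq_nonneg _)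
    (fun i a => sum_normSq_col
      (mem_unitaryGroup_iff'.1 (mul_mem hWsm (mul_mem (hUm i) hVm))) a)
    (l := l) (μ := μ) hρ.eigenvalues_nonneg (sum_eigenvalues_eq_one _ hρ1)
    (fun b => by
      have e : ∀ i, ∑ a, Complex.normSq ((Wᴴ * (U i * V)) b a) * l a =
          ((Wᴴ * (U i * ρ * (U i)ᴴ) * W) b b).re := by
        intro i
        rw [← diag_conj_re, hσs]
        simp only [conjTranspose_mul, conjTranspose_conjTranspose, Matrix.mul_assoc]
      have hdiag : Wᴴ * τ * W = diagonal (fun b => (μ b : ℂ)) := by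
        have hWW : Wᴴ * W = 1 := mem_unitaryGroup_iff'.1 hWm
        rw [hτs, Matrix.mul_assoc, Matrix.mul_assoc _ Wᴴ W, hWW, Matrix.mul_one,
          ← Matrix.mul_assoc, hWW, Matrix.one_mul]
      have hbb := congrArg Complex.re (congrFun (congrFun hdiag b) b)
      rw [hτρ] at hbb
      simp only [Fintype.sum_bool, e]
      simp only [Matrix.mul_smul, Matrix.smul_mul, Matrix.mul_add, Matrix.add_mul, diagonal_apply_eq,
        Complex.ofReal_re, Matrix.smul_apply, Matrix.add_apply] at hbb
      rw [← hbb, hU]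
      simp)
    (m := m) (by linarith) hm1
    (fun t ht => by
      have := resolvent_sum_ge (mem_unitaryGroup_iff.1 (mul_mem hU₀ hVm))
        (mem_unitaryGroup_iff.1 (mul_mem hU₁ hVm)) (mem_unitaryGroup_iff.1 hWm) hPh hP2
        hρ.eigenvalues_nonneg hτ.eigenvalues_nonneg (hσs U₀) (hσs U₁) hτs hσ₀1 hσ₁1 hτ1 hm
        (by linarith) hm1 ht
      rw [Fintype.sum_bool, mul_add, hU]
      exact this)
  have hlog : 0 < Real.log 2 := Real.log_pos one_lt_two
  have e1 := vnEntropy_mul_log_two hρ.isHermitian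
  have e2 := vnEntropy_mul_log_two hτ.isHermitian
  have e3 := binH_mul_log_two p
  rw [← hl] at e1
  rw [← hμ] at e2
  refine le_of_mul_le_mul_right ?_ hlog
  linarith

/-- Claim (claim-incr): if a restricted QFA for `L_n` starts in a pure state `ρ₀ = |ψ⟩⟨ψ|`,
evolves by `ρ_k = ½(U₀ ρ_{k−1} U₀† + U₁ ρ_{k−1} U₁†)` on a uniformly random input, and
the final measurement `(I − P, P)` identifies the last symbol with probability at least
`p > 1/2`, then `S(ρ_k) ≥ (1 − H(p))·k` for every `k ≤ n`. -/
theorem entropy_growth_of_qfa {d n : ℕ} (p : ℝ) (hp : 1 / 2 < p) (hp1 : p ≤ 1)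
    (U₀ U₁ : Matrix (Fin d) (Fin d) ℂ)
    (hU₀ : U₀ ∈ Matrix.unitaryGroup (Fin d) ℂ)
    (hU₁ : U₁ ∈ Matrix.unitaryGroup (Fin d) ℂ)
    (P : Matrix (Fin d) (Fin d) ℂ) (hPh : P.IsHermitian) (hP2 : P * P = P)
    (ψ : Fin d → ℂ) (hψ : star ψ ⬝ᵥ ψ = 1)
    (ρ : ℕ → Matrix (Fin d) (Fin d) ℂ)
    (hρ0 : ρ 0 = Matrix.vecMulVec ψ (star ψ))
    (hrec : ∀ k, ρ (k + 1) = (1 / 2 : ℂ) • (U₀ * ρ k * U₀ᴴ + U₁ * ρ k * U₁ᴴ))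
    (hmeas : ∀ k < n, p ≤ (((1 - P) * (U₀ * ρ k * U₀ᴴ)).trace).re ∧
                      p ≤ ((P * (U₁ * ρ k * U₁ᴴ)).trace).re) :
    ∀ k ≤ n, vnEntropy (ρ k) ≥ (1 - binH p) * k := by
  have hstate : ∀ k, (ρ k).PosSemidef ∧ (ρ k).trace = 1 := by
    intro k
    induction k with
    | zero =>
      rw [hρ0]
      exact ⟨posSemidef_vecMulVec_self_star ψ, by rw [trace_vecMulVec, dotProduct_comm, hψ]⟩
    | succ k ih =>
      rw [hrec]
      refine ⟨((ih.1.mul_mul_conjTranspose_same U₀).add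
        (ih.1.mul_mul_conjTranspose_same U₁)).smul
        (by rw [Complex.le_def]; norm_num), ?_⟩
      rw [trace_smul, trace_add, trace_unitary_conj hU₀, trace_unitary_conj hU₁, ih.2]
      norm_num
  intro k
  induction k with
  | zero =>
    intro _
    simpa using vnEntropy_nonneg (hstate 0).1 (hstate 0).2
  | succ k ih =>
    intro hk
    have hstep := vnEntropy_add_le hp hU₀ hU₁ hPh hP2 (hstate k).1 (hstate k).2
      (hstate (k + 1)).1 (hstate (k + 1)).2 (hrec k) (hmeas k hk).1 (hmeas k hk).2
    have := ih (Nat.le_of_succ_le hk)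
    push_cast
    linarith
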